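/- Let k and a be integers with 1 ≤ a < k and k − a odd, let q be a complex number with 0 < |q| < 1, and let c be a complex number with c² = q. Then ∑_{N_1 ≥ N_2 ≥ ⋯ ≥ N_{k−1} ≥ 0} c^{N_1² + N_2² + ⋯ + N_{k−1}²} q^{N_a + N_{a+2} + ⋯ + N_{k−1}} (−c;q)_{N_{k−1}} / ((q;q)_{N_1−N_2} (q;q)_{N_2−N_3} ⋯ (q;q)_{N_{k−2}−N_{k−1}} (q²;q²)_{N_{k−1}}) = ((−c;q)_∞ / (q;q)_∞) · (1 + ∑_{r=1}^{∞} (−1)^r c^{(k+1)r²} (c^{(k−a+1)r} + c^{−(k−a+1)r})), where on the left the sum is over all weakly decreasing (k−1)-tuples of nonnegative integers, the subscripts a, a+2, …, k−1 increase in steps of 2, and both sums converge absolutely. -/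

import Mathlib

open Finset

/-- Finite q-Pochhammer symbol `(x;q)_n`. -/
noncomputable def qPoch (q x : ℂ) (n : ℕ) : ℂ :=
  ∏ j ∈ Finset.range n, (1 - x * q ^ j)

/-- Infinite q-Pochhammer symbol `(x;q)_∞`. -/
noncomputable def qPochInf (q x : ℂ) : ℂ :=
  ∏' j : ℕ, (1 - x * q ^ j)

/-- Extend a tuple `N : Fin m → ℕ` (listing `N_1, …, N_m`, 1-based) to `ℕ`, with value
`0` for indices `> m`. -/
def ext (m : ℕ) (N : Fin m → ℕ) (i : ℕ) : ℕ :=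
  if h : i - 1 < m then N ⟨i - 1, h⟩ else 0

/-- Summand of the multisum side of identity (4.1): `c` is a fixed square root of `q`,
the exponent of `q` runs over `a, a+2, …, k-1`, and the denominator is
`(q;q)_{N_1-N_2} ⋯ (q;q)_{N_{k-2}-N_{k-1}} (q²;q²)_{N_{k-1}}`. -/
noncomputable def halfTerm (k a : ℕ) (q c : ℂ) (N : Fin (k - 1) → ℕ) : ℂ :=
  c ^ (∑ i ∈ Finset.Icc 1 (k - 1), (ext (k - 1) N i) ^ 2) *
      q ^ (∑ i ∈ (Finset.Icc a (k - 1)).filter (fun i => i % 2 = a % 2), ext (k - 1) N i) *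
      qPoch q (-c) (ext (k - 1) N (k - 1)) /
    ((∏ i ∈ Finset.Icc 1 (k - 2), qPoch q q (ext (k - 1) N i - ext (k - 1) N (i + 1))) *
      qPoch (q ^ 2) (q ^ 2) (ext (k - 1) N (k - 1)))

/-- The `r`-th term of the theta-type series on the right-hand side of (4.1). -/
noncomputable def thetaTerm (k a : ℕ) (c : ℂ) (r : ℕ) : ℂ :=
  (-1 : ℂ) ^ r * c ^ ((k + 1) * r ^ 2) *
    (c ^ ((k - a + 1) * r) + c ^ (-(((k - a + 1) * r : ℕ) : ℤ)))

lemma norm_lt_one_of_sq_eq {q c : ℂ} (hq1 : ‖q‖ < 1) (hc : c ^ 2 = q) : ‖c‖ < 1 := by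
  rw [← hc, norm_pow] at hq1
  exact (pow_lt_one_iff_of_nonneg (norm_nonneg c) two_ne_zero).mp hq1

lemma ne_zero_of_sq_eq {q c : ℂ} (hq0 : 0 < ‖q‖) (hc : c ^ 2 = q) : c ≠ 0 := by
  rintro rfl
  simp [← hc] at hq0

lemma qPoch_succ (q x : ℂ) (n : ℕ) : qPoch q x (n + 1) = qPoch q x n * (1 - x * q ^ n) :=
  Finset.prod_range_succ _ _

lemma qPoch_add (q x : ℂ) (m n : ℕ) :
    qPoch q x (m + n) = qPoch q x m * qPoch q (x * q ^ m) n := by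
  simp only [qPoch, Finset.prod_range_add, pow_add, mul_assoc]

lemma qPoch_succ_left (q x : ℂ) (n : ℕ) : qPoch q x (n + 1) = (1 - x) * qPoch q (x * q) n := by
  rw [add_comm, qPoch_add]
  simp [qPoch]

lemma one_sub_pow_succ_ne_zero {q : ℂ} (hq1 : ‖q‖ < 1) (n : ℕ) : 1 - q ^ (n + 1) ≠ 0 := by
  intro h
  have h1 : ‖q ^ (n + 1)‖ = 1 := by rw [← sub_eq_zero.mp h, norm_one]
  rw [norm_pow] at h1
  exact (pow_lt_one₀ (norm_nonneg q) hq1 n.succ_ne_zero).ne h1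

lemma qPoch_self_ne_zero {q : ℂ} (hq1 : ‖q‖ < 1) (n : ℕ) : qPoch q q n ≠ 0 :=
  Finset.prod_ne_zero_iff.mpr fun j _ => by
    rw [← pow_succ']
    exact one_sub_pow_succ_ne_zero hq1 j

/-- The reciprocal `1 / (q;q)_z`, extended by zero to negative integers `z`. -/
noncomputable def qFactInv (q : ℂ) (z : ℤ) : ℂ :=
  if z < 0 then 0 else (qPoch q q z.toNat)⁻¹

lemma qFactInv_of_neg (q : ℂ) {z : ℤ} (hz : z < 0) : qFactInv q z = 0 := if_pos hz

lemma qFactInv_natCast (q : ℂ) (n : ℕ) : qFactInv q n = (qPoch q q n)⁻¹ := by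
  simp [qFactInv]

lemma qFactInv_sub_one {q : ℂ} (hq1 : ‖q‖ < 1) (z : ℤ) :
    qFactInv q (z - 1) = (1 - q ^ z) * qFactInv q z := by
  rcases lt_trichotomy z 0 with hz | rfl | hz
  · rw [qFactInv_of_neg q hz, qFactInv_of_neg q (by omega), mul_zero]
  · simp [qFactInv]
  · obtain ⟨n, rfl⟩ : ∃ n : ℕ, z = n + 1 := ⟨(z - 1).toNat, by omega⟩
    have h := one_sub_pow_succ_ne_zero hq1 n
    have h' := qPoch_self_ne_zero hq1 n
    rw [add_sub_cancel_right, show (n : ℤ) + 1 = ((n + 1 : ℕ) : ℤ) by push_cast; rfl,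
      qFactInv_natCast, qFactInv_natCast, qPoch_succ, zpow_natCast, ← pow_succ']
    field_simp

/-- Splitting off the first factors of `(q;q)`, in reciprocal form. -/
lemma qFactInv_add {q : ℂ} (hq1 : ‖q‖ < 1) (m n : ℕ) :
    qFactInv q m = qFactInv q ((m + n : ℕ) : ℤ) * qPoch q (q ^ (m + 1)) n := by
  have h := qPoch_self_ne_zero hq1 m
  have h' := qPoch_self_ne_zero hq1 (m + n)
  rw [qFactInv_natCast, qFactInv_natCast, eq_inv_mul_iff_mul_eq₀ h', qPoch_add, ← pow_succ']
  field_simp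

/-- The q-Chu–Vandermonde summation. -/
lemma qChuVandermonde {q : ℂ} (hq1 : ‖q‖ < 1) (y : ℂ) (M : ℕ) (b : ℂ) :
    ∑ j ∈ range (M + 1), qFactInv q j * qFactInv q ((M : ℤ) - j) *
      ((-y) ^ j * q ^ (j.choose 2) * qPoch q b j * qPoch q (b * y * q ^ j) (M - j)) =
    qFactInv q M * qPoch q y M := by
  induction M generalizing b with
  | zero => simp [qPoch, qFactInv]
  | succ M ih =>
    have hM := one_sub_pow_succ_ne_zero hq1 M
    refine mul_left_cancel₀ hM ?_
    have hrec : (1 - q ^ (M + 1)) * qFactInv q ((M + 1 : ℕ) : ℤ) = qFactInv q M := by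
      have := qFactInv_sub_one hq1 ((M + 1 : ℕ) : ℤ)
      rw [zpow_natCast] at this
      rw [← this]
      congr 1
      push_cast
      ring
    have hpascal : ∀ j : ℕ, j ≤ M + 1 → (1 - q ^ (M + 1)) *
        (qFactInv q j * qFactInv q (((M + 1 : ℕ) : ℤ) - j)) =
        qFactInv q j * qFactInv q ((M : ℤ) - j) +
        q ^ (M + 1 - j) * (qFactInv q ((j : ℤ) - 1) * qFactInv q (((M + 1 : ℕ) : ℤ) - j)) := by
      intro j hj
      obtain ⟨i, hi⟩ := Nat.exists_eq_add_of_le hj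
      have h1 := qFactInv_sub_one hq1 (j : ℤ)
      have h2 := qFactInv_sub_one hq1 (((M + 1 : ℕ) : ℤ) - j)
      rw [show ((M + 1 : ℕ) : ℤ) - j - 1 = (M : ℤ) - j by push_cast; ring,
        show ((M + 1 : ℕ) : ℤ) - j = (i : ℤ) by rw [hi]; push_cast; ring] at h2
      rw [zpow_natCast] at h1 h2
      rw [h1, h2, show ((M + 1 : ℕ) : ℤ) - j = (i : ℤ) by rw [hi]; push_cast; ring, hi,
        Nat.add_sub_cancel_left, pow_add]
      ring
    have hsplit : ∀ j ∈ range (M + 1 + 1), (1 - q ^ (M + 1)) *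
        (qFactInv q j * qFactInv q (((M + 1 : ℕ) : ℤ) - j) *
          ((-y) ^ j * q ^ (j.choose 2) * qPoch q b j * qPoch q (b * y * q ^ j) (M + 1 - j))) =
        qFactInv q j * qFactInv q ((M : ℤ) - j) *
          ((-y) ^ j * q ^ (j.choose 2) * qPoch q b j * qPoch q (b * y * q ^ j) (M + 1 - j)) +
        q ^ (M + 1 - j) * (qFactInv q ((j : ℤ) - 1) * qFactInv q (((M + 1 : ℕ) : ℤ) - j)) *
          ((-y) ^ j * q ^ (j.choose 2) * qPoch q b j * qPoch q (b * y * q ^ j) (M + 1 - j)) := by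
      intro j hj
      rw [← mul_assoc, hpascal j (by simp at hj; omega)]
      ring
    rw [mul_sum, sum_congr rfl hsplit, sum_add_distrib, sum_range_succ,
      qFactInv_of_neg q (show (M : ℤ) - ((M + 1 : ℕ) : ℤ) < 0 by push_cast; omega),
      sum_range_succ' _ (M + 1)]
    have hfirst : ∀ j ∈ range (M + 1), qFactInv q j * qFactInv q ((M : ℤ) - j) *
          ((-y) ^ j * q ^ (j.choose 2) * qPoch q b j * qPoch q (b * y * q ^ j) (M + 1 - j)) =
        (1 - b * y * q ^ M) * (qFactInv q j * qFactInv q ((M : ℤ) - j) *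
          ((-y) ^ j * q ^ (j.choose 2) * qPoch q b j * qPoch q (b * y * q ^ j) (M - j))) := by
      intro j hj
      obtain ⟨i, rfl⟩ := Nat.exists_eq_add_of_le (Nat.lt_succ_iff.mp (mem_range.mp hj))
      rw [show j + i + 1 - j = i + 1 by omega, show j + i - j = i by omega, qPoch_succ, pow_add]
      ring
    have hsecond : ∀ j ∈ range (M + 1), q ^ (M + 1 - (j + 1)) *
        (qFactInv q (((j + 1 : ℕ) : ℤ) - 1) * qFactInv q (((M + 1 : ℕ) : ℤ) - ((j + 1 : ℕ) : ℤ))) *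
          ((-y) ^ (j + 1) * q ^ ((j + 1).choose 2) * qPoch q b (j + 1) *
            qPoch q (b * y * q ^ (j + 1)) (M + 1 - (j + 1))) =
        (-y * (1 - b) * q ^ M) * (qFactInv q j * qFactInv q ((M : ℤ) - j) *
          ((-y) ^ j * q ^ (j.choose 2) * qPoch q (b * q) j *
            qPoch q (b * q * y * q ^ j) (M - j))) := by
      intro j hj
      obtain ⟨i, rfl⟩ := Nat.exists_eq_add_of_le (Nat.lt_succ_iff.mp (mem_range.mp hj))
      rw [show j + i + 1 - (j + 1) = i by omega, show j + i - j = i by omega, qPoch_succ_left,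
        show ((j + 1 : ℕ) : ℤ) - 1 = j by push_cast; ring,
        show ((j + i + 1 : ℕ) : ℤ) - ((j + 1 : ℕ) : ℤ) = ((j + i : ℕ) : ℤ) - j by push_cast; ring,
        show (j + 1).choose 2 = j + j.choose 2 by simp [Nat.choose_succ_succ' j 1],
        show b * y * q ^ (j + 1) = b * q * y * q ^ j by ring]
      ring
    rw [sum_congr rfl hfirst, sum_congr rfl hsecond, ← mul_sum, ← mul_sum, ih b, ih (b * q),
      qFactInv_of_neg q (show ((0 : ℕ) : ℤ) - 1 < 0 by norm_num), ← mul_assoc (1 - q ^ (M + 1)), hrec,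
      qPoch_succ q y M]
    ring

/-- The summation behind a Bailey step, for a nonnegative index. -/
lemma baileyKernel_natCast {q c : ℂ} (hq1 : ‖q‖ < 1) (hc : c ^ 2 = q) (d r M : ℕ) :
    ∑ N ∈ range (r + M + 1), c ^ (N ^ 2) * q ^ (d * N) * qPoch q (-c) N *
      qFactInv q (((r + M : ℕ) : ℤ) - N) * (qFactInv q ((N : ℤ) - r) *
        qFactInv q ((N : ℤ) + r + d)) =
    c ^ (r ^ 2) * q ^ (d * r) * qPoch q (-c) r * qPoch q (-c * q ^ (r + d)) M *
      (qFactInv q (((r + M : ℕ) : ℤ) - r) * qFactInv q (((r + M : ℕ) : ℤ) + r + d)) := by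
  have hterm : ∀ j ∈ range (M + 1), c ^ ((r + j) ^ 2) * q ^ (d * (r + j)) * qPoch q (-c) (r + j) *
      qFactInv q (((r + M : ℕ) : ℤ) - ((r + j : ℕ) : ℤ)) * (qFactInv q (((r + j : ℕ) : ℤ) - r) *
        qFactInv q (((r + j : ℕ) : ℤ) + r + d)) =
      c ^ (r ^ 2) * q ^ (d * r) * qPoch q (-c) r * qFactInv q (((r + M : ℕ) : ℤ) + r + d) *
      (qFactInv q j * qFactInv q ((M : ℤ) - j) *
      ((-(-c * q ^ (r + d))) ^ j * q ^ (j.choose 2) * qPoch q (-c * q ^ r) j *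
        qPoch q ((-c * q ^ r) * (-c * q ^ (r + d)) * q ^ j) (M - j))) := by
    intro j hj
    obtain ⟨i, rfl⟩ := Nat.exists_eq_add_of_le (Nat.lt_succ_iff.mp (mem_range.mp hj))
    have hchoose : 2 * j.choose 2 + j = j ^ 2 := by
      rw [Nat.choose_two_right, Nat.mul_div_cancel' (Nat.even_mul_pred_self j).two_dvd]
      cases j with
      | zero => rfl
      | succ j => rw [Nat.add_sub_cancel]; ring
    have hpow : c ^ ((r + j) ^ 2) = c ^ (r ^ 2) * (q ^ (r * j) * (c ^ j * q ^ (j.choose 2))) := by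
      rw [add_sq, ← hchoose, ← hc]
      simp only [← pow_mul, ← pow_add]
      congr 1
      ring
    have hden := qFactInv_add hq1 (2 * r + j + d) i
    rw [show ((r + j : ℕ) : ℤ) + r + d = ((2 * r + j + d : ℕ) : ℤ) by push_cast; ring, hden,
      show ((r + (j + i) : ℕ) : ℤ) + r + d = ((2 * r + j + d + i : ℕ) : ℤ) by push_cast; ring,
      show ((r + j : ℕ) : ℤ) - r = j by push_cast; ring,
      show ((r + (j + i) : ℕ) : ℤ) - ((r + j : ℕ) : ℤ) = ((j + i : ℕ) : ℤ) - j by push_cast; ring,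
      qPoch_add, hpow, Nat.add_sub_cancel_left,
      show (-c * q ^ r) * (-c * q ^ (r + d)) * q ^ j = q ^ (2 * r + j + d + 1) by
        rw [show (-c * q ^ r) * (-c * q ^ (r + d)) = c ^ 2 * (q ^ r * q ^ (r + d)) by ring, hc]
        ring]
    ring
  rw [show r + M + 1 = r + (M + 1) by ring, sum_range_add, sum_congr rfl hterm, ← mul_sum,
    qChuVandermonde hq1, sum_eq_zero, zero_add, show ((r + M : ℕ) : ℤ) - r = M by push_cast; ring]
  · ring
  · intro N hN
    rw [qFactInv_of_neg q (show (N : ℤ) - r < 0 by simp at hN; omega)]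
    ring

lemma baileyKernel {q c : ℂ} (hq1 : ‖q‖ < 1) (hc : c ^ 2 = q) (n : ℕ) (r : ℤ) :
    ∑ N ∈ range (n + 1), c ^ (N ^ 2) * qPoch q (-c) N * qFactInv q ((n : ℤ) - N) *
      (qFactInv q ((N : ℤ) - r) * qFactInv q ((N : ℤ) + r)) =
    c ^ (r ^ 2) * qPoch q (-c) n * (qFactInv q ((n : ℤ) - r) * qFactInv q ((n : ℤ) + r)) := by
  wlog hr : 0 ≤ r generalizing r
  · have h := this (-r) (by omega)
    simp only [sub_neg_eq_add, ← sub_eq_add_neg, neg_sq] at h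
    simpa only [mul_comm (qFactInv q (_ - r))] using h
  lift r to ℕ using hr
  rcases lt_or_ge n r with hn | hn
  · rw [qFactInv_of_neg q (show (n : ℤ) - r < 0 by omega), zero_mul, mul_zero]
    refine sum_eq_zero fun N hN => ?_
    rw [qFactInv_of_neg q (show (N : ℤ) - r < 0 by simp at hN; omega)]
    ring
  · obtain ⟨M, rfl⟩ := Nat.exists_eq_add_of_le hn
    have h := baileyKernel_natCast hq1 hc 0 r M
    simp only [zero_mul, pow_zero, mul_one, add_zero, Nat.cast_zero] at h
    rw [h, qPoch_add]
    norm_cast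
    ring

lemma one_add_mul_zpow_ne_zero {q c : ℂ} (hq0 : 0 < ‖q‖) (hq1 : ‖q‖ < 1) (hc : c ^ 2 = q)
    (r : ℤ) : 1 + c * q ^ r ≠ 0 := by
  intro h
  have hc0 := ne_zero_of_sq_eq hq0 hc
  have hc1 := norm_lt_one_of_sq_eq hq1 hc
  have h1 : ‖c ^ (2 * r + 1)‖ = 1 := by
    rw [zpow_add₀ hc0, zpow_mul, zpow_one, mul_comm, zpow_ofNat, hc,
      eq_neg_of_add_eq_zero_right h, norm_neg, norm_one]
  rw [norm_zpow, zpow_eq_one_iff_right₀ (norm_nonneg c) hc1.ne] at h1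
  omega

lemma baileyKernel_twisted {q c : ℂ} (hq0 : 0 < ‖q‖) (hq1 : ‖q‖ < 1) (hc : c ^ 2 = q) (n : ℕ)
    (r : ℤ) :
    ∑ N ∈ range (n + 1), c ^ (N ^ 2) * q ^ N * qPoch q (-c) N * qFactInv q ((n : ℤ) - N) *
      (qFactInv q ((N : ℤ) - r) * qFactInv q ((N : ℤ) + r + 1)) =
    c ^ (r ^ 2) * q ^ r / (1 + c * q ^ r) * qPoch q (-c) (n + 1) *
      (qFactInv q ((n : ℤ) - r) * qFactInv q ((n : ℤ) + r + 1)) := by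
  have hc0 := ne_zero_of_sq_eq hq0 hc
  wlog hr : 0 ≤ r generalizing r
  · have h := this (-1 - r) (by omega)
    have h1 : c ^ ((-1 - r) ^ 2) * q ^ (-1 - r) / (1 + c * q ^ (-1 - r)) =
        c ^ (r ^ 2) * q ^ r / (1 + c * q ^ r) := by
      rw [div_eq_div_iff (one_add_mul_zpow_ne_zero hq0 hq1 hc _)
        (one_add_mul_zpow_ne_zero hq0 hq1 hc _)]
      have hq : ∀ z : ℤ, q ^ z = c ^ (2 * z) := fun z => by rw [zpow_mul, zpow_ofNat, hc]
      have e1 : c ^ ((-1 - r) ^ 2) * q ^ (-1 - r) * (c * q ^ r) = c ^ (r ^ 2) * q ^ r := by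
        rw [hq, hq, ← zpow_one_add₀ hc0, ← zpow_add₀ hc0, ← zpow_add₀ hc0, ← zpow_add₀ hc0]
        congr 1
        ring
      have e2 : c ^ ((-1 - r) ^ 2) * q ^ (-1 - r) = c ^ (r ^ 2) * q ^ r * (c * q ^ (-1 - r)) := by
        rw [hq, hq, ← zpow_one_add₀ hc0, ← zpow_add₀ hc0, ← zpow_add₀ hc0, ← zpow_add₀ hc0]
        congr 1
        ring
      linear_combination e1 + e2
    rw [h1] at h
    have hl : ∀ x : ℤ, x - (-1 - r) = x + r + 1 := fun x => by ring
    have hl' : ∀ x : ℤ, x + (-1 - r) + 1 = x - r := fun x => by ring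
    simp only [hl, hl'] at h
    simpa only [mul_comm (qFactInv q (_ - r))] using h
  lift r to ℕ using hr
  rcases lt_or_ge n r with hn | hn
  · rw [qFactInv_of_neg q (show (n : ℤ) - r < 0 by omega), zero_mul, mul_zero]
    refine sum_eq_zero fun N hN => ?_
    rw [qFactInv_of_neg q (show (N : ℤ) - r < 0 by simp at hN; omega)]
    ring
  · obtain ⟨M, rfl⟩ := Nat.exists_eq_add_of_le hn
    have h := baileyKernel_natCast hq1 hc 1 r M
    have h0 := one_add_mul_zpow_ne_zero hq0 hq1 hc r
    simp only [one_mul, Nat.cast_one] at h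
    rw [h, add_assoc r M 1, add_comm M 1, ← add_assoc, qPoch_add, qPoch_succ]
    rw [zpow_natCast] at h0
    rw [show (r : ℤ) ^ 2 = ((r ^ 2 : ℕ) : ℤ) by push_cast; rfl, zpow_natCast, zpow_natCast,
      show 1 - -c * q ^ r = 1 + c * q ^ r by ring]
    generalize q ^ r = x at h0 ⊢
    rw [mul_comm c x] at h0 ⊢
    field_simp

/-- The theta coefficient `(-1)^r c^(s r² + t r)`. -/
noncomputable def thetaCoeff (c : ℂ) (s t r : ℤ) : ℂ := (-1) ^ r * c ^ (s * r ^ 2 + t * r)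

/-- The finite sum `∑_r (-1)^r c^(s r² + t r) / ((q;q)_{n-r} (q;q)_{n+r})`, that is, the
`β`-side of the Bailey pair with (bilateral) `α`-side `thetaCoeff c s t`. -/
noncomputable def baileyBeta (q c : ℂ) (s t : ℤ) (n : ℕ) : ℂ :=
  ∑ r ∈ Icc (-(n : ℤ)) n, thetaCoeff c s t r * (qFactInv q ((n : ℤ) - r) * qFactInv q ((n : ℤ) + r))

lemma baileyBeta_summand_eq_zero (q c : ℂ) (s t : ℤ) (n : ℕ) {r : ℤ}
    (hr : r ∉ Icc (-(n : ℤ)) n) :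
    thetaCoeff c s t r * (qFactInv q ((n : ℤ) - r) * qFactInv q ((n : ℤ) + r)) = 0 := by
  rcases lt_or_ge (n : ℤ) r with h | h
  · rw [qFactInv_of_neg q (show (n : ℤ) - r < 0 by omega), zero_mul, mul_zero]
  · rw [qFactInv_of_neg q (show (n : ℤ) + r < 0 by simp at hr; omega), mul_zero, mul_zero]

lemma baileyBeta_eq_sum (q c : ℂ) (s t : ℤ) {n : ℕ} {S : Finset ℤ} (hS : Icc (-(n : ℤ)) n ⊆ S) :
    baileyBeta q c s t n =
      ∑ r ∈ S, thetaCoeff c s t r * (qFactInv q ((n : ℤ) - r) * qFactInv q ((n : ℤ) + r)) :=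
  sum_subset hS fun _ _ hr => baileyBeta_summand_eq_zero q c s t n hr

lemma sum_Icc_eq_zero_of_antisymm (M : ℤ) {f : ℤ → ℂ} (hf : ∀ r, f (-1 - r) = -f r) :
    ∑ r ∈ Icc (-M - 1) M, f r = 0 := by
  have h : ∑ r ∈ Icc (-M - 1) M, f r = ∑ r ∈ Icc (-M - 1) M, -f r :=
    sum_nbij' (fun r => -1 - r) (fun r => -1 - r) (by simp; omega) (by simp; omega) (by simp)
      (by simp) (fun r _ => by rw [hf, neg_neg])
  rw [sum_neg_distrib] at h
  exact self_eq_neg.mp h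

lemma thetaCoeff_reflect {c : ℂ} (hc0 : c ≠ 0) (s t r : ℤ) :
    thetaCoeff c s t (-1 - r) = -(thetaCoeff c s t r * c ^ ((s - t) * (2 * r + 1))) := by
  rw [thetaCoeff, thetaCoeff, mul_assoc, ← zpow_add₀ hc0,
    show s * (-1 - r) ^ 2 + t * (-1 - r) = s * r ^ 2 + t * r + (s - t) * (2 * r + 1) by ring,
    zpow_sub₀ (by norm_num), zpow_neg_one]
  rcases Int.even_or_odd r with h | h
  · simp [h.neg_one_zpow]
  · simp [h.neg_one_zpow]

lemma thetaCoeff_mul_zpow {c : ℂ} (hc0 : c ≠ 0) (s t u r : ℤ) :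
    thetaCoeff c s t r * c ^ (u * r) = thetaCoeff c s (t + u) r := by
  rw [thetaCoeff, thetaCoeff, mul_assoc, ← zpow_add₀ hc0]
  congr 2
  ring

lemma thetaCoeff_mul_zpow_sq {c : ℂ} (hc0 : c ≠ 0) (s t r : ℤ) :
    thetaCoeff c s t r * c ^ (r ^ 2) = thetaCoeff c (s + 1) t r := by
  rw [thetaCoeff, thetaCoeff, mul_assoc, ← zpow_add₀ hc0]
  congr 2
  ring

section BaileySteps

variable {q c : ℂ} (hq0 : 0 < ‖q‖) (hq1 : ‖q‖ < 1) (hc : c ^ 2 = q)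
include hq0 hq1 hc

lemma baileyBeta_succ_two_zero (n : ℕ) :
    (1 - q ^ (2 * (n + 1))) * baileyBeta q c 2 0 (n + 1) = baileyBeta q c 2 0 n := by
  have hqne : q ≠ 0 := norm_pos_iff.mp hq0
  have hc0 := ne_zero_of_sq_eq hq0 hc
  have hq : ∀ z : ℤ, q ^ z = c ^ (2 * z) := fun z => by rw [zpow_mul, zpow_ofNat, hc]
  set m : ℤ := (n : ℤ) + 1 with hm
  have hmn : ((n + 1 : ℕ) : ℤ) = m := by push_cast; rfl
  have hvanish : ∑ r ∈ Icc (-m) m, thetaCoeff c 2 0 r * q ^ (m + r) *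
      (qFactInv q (m - r - 1) * qFactInv q (m + r)) = 0 := by
    rw [sum_subset (s₂ := Icc (-m - 1) m) (Icc_subset_Icc (by omega) le_rfl)]
    · refine sum_Icc_eq_zero_of_antisymm m fun r => ?_
      rw [show m - (-1 - r) - 1 = m + r by ring, show m + (-1 - r) = m - r - 1 by ring,
        thetaCoeff_reflect hc0, hq, hq,
        show thetaCoeff c 2 0 r * c ^ (2 * (m + r)) =
          thetaCoeff c 2 0 r * c ^ ((2 - 0) * (2 * r + 1)) * c ^ (2 * (m - r - 1)) by
          rw [mul_assoc, ← zpow_add₀ hc0]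
          congr 2
          ring]
      ring
    · intro r h1 h2
      rw [qFactInv_of_neg q (show m + r < 0 by simp at h1 h2; omega)]
      ring
  have hvanish' : ∑ r ∈ Icc (-m) m, thetaCoeff c 2 0 r * q ^ (m - r) *
      (qFactInv q (m - r) * qFactInv q (m + r - 1)) = 0 := by
    rw [← hvanish]
    refine sum_nbij' (fun r => -r) (fun r => -r) (by simp; omega) (by simp; omega) (by simp)
      (by simp) (fun r _ => ?_)
    rw [← sub_eq_add_neg, sub_neg_eq_add, mul_comm (qFactInv q (m - r))]
    simp [thetaCoeff, ← inv_zpow]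
  rw [baileyBeta_eq_sum q c 2 0 (S := Icc (-m) m) (n := n) (Icc_subset_Icc (by omega) (by omega)),
    baileyBeta, hmn, ← sub_eq_zero, mul_sum, ← sum_sub_distrib, ← add_zero (0 : ℂ)]
  nth_rw 2 [← hvanish]
  rw [← hvanish', ← sum_add_distrib]
  refine sum_congr rfl fun r _ => ?_
  have e1 := qFactInv_sub_one hq1 (m - r)
  have e2 := qFactInv_sub_one hq1 (m + r)
  rw [show (n : ℤ) - r = m - r - 1 by omega, show (n : ℤ) + r = m + r - 1 by omega, e1, e2]
  have e3 : q ^ (2 * (n + 1)) = q ^ (m - r) * q ^ (m + r) := by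
    rw [← zpow_add₀ hqne, ← zpow_natCast]
    congr 1
    push_cast
    ring
  rw [e3]
  ring

lemma baileyBeta_two_zero (n : ℕ) : baileyBeta q c 2 0 n = (qPoch (q ^ 2) (q ^ 2) n)⁻¹ := by
  induction n with
  | zero => simp [baileyBeta, thetaCoeff, qFactInv, qPoch]
  | succ n ih =>
    have h := baileyBeta_succ_two_zero hq0 hq1 hc n
    have h1 : 1 - q ^ (2 * (n + 1)) ≠ 0 := one_sub_pow_succ_ne_zero hq1 (2 * n + 1)
    rw [qPoch_succ, mul_inv, ← ih, ← h, ← pow_succ', ← pow_mul]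
    field_simp

lemma baileyBeta_step (s t : ℤ) (n : ℕ) :
    ∑ N ∈ range (n + 1), c ^ (N ^ 2) * qFactInv q ((n : ℤ) - N) *
      (qPoch q (-c) N * baileyBeta q c s t N) =
    qPoch q (-c) n * baileyBeta q c (s + 1) t n := by
  have hc0 := ne_zero_of_sq_eq hq0 hc
  have h : ∀ N ∈ range (n + 1), c ^ (N ^ 2) * qFactInv q ((n : ℤ) - N) *
      (qPoch q (-c) N * baileyBeta q c s t N) = ∑ r ∈ Icc (-(n : ℤ)) n, thetaCoeff c s t r *
        (c ^ (N ^ 2) * qPoch q (-c) N * qFactInv q ((n : ℤ) - N) *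
          (qFactInv q ((N : ℤ) - r) * qFactInv q ((N : ℤ) + r))) := by
    intro N hN
    have hN' := mem_range.mp hN
    rw [baileyBeta_eq_sum q c s t (S := Icc (-(n : ℤ)) n) (n := N)
      (Icc_subset_Icc (by omega) (by omega)), mul_sum, mul_sum]
    exact sum_congr rfl fun r _ => by ring
  rw [sum_congr rfl h, sum_comm, baileyBeta, mul_sum]
  refine sum_congr rfl fun r _ => ?_
  rw [← mul_sum, baileyKernel hq1 hc, ← thetaCoeff_mul_zpow_sq hc0]
  ring

/-- For `s = t + 2` the sum `baileyBeta` agrees with its analogue relative to `q`. -/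
lemma baileyBeta_eq_sum_relative (t : ℤ) {n M : ℕ} (hn : n ≤ M) :
    baileyBeta q c (t + 2) t n = ∑ r ∈ Icc (-(M : ℤ) - 1) M, thetaCoeff c (t + 2) t r *
      (qFactInv q ((n : ℤ) - r) * qFactInv q ((n : ℤ) + r + 1)) := by
  have hc0 := ne_zero_of_sq_eq hq0 hc
  have hqne : q ≠ 0 := norm_pos_iff.mp hq0
  have hvanish : ∑ r ∈ Icc (-(M : ℤ) - 1) M, q ^ ((n : ℤ) + 1) * (thetaCoeff c (t + 2) (t + 2) r *
      (qFactInv q ((n : ℤ) - r) * qFactInv q ((n : ℤ) + r + 1))) = 0 := by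
    refine sum_Icc_eq_zero_of_antisymm _ fun r => ?_
    rw [thetaCoeff_reflect hc0, show (n : ℤ) - (-1 - r) = n + r + 1 by ring,
      show (n : ℤ) + (-1 - r) + 1 = n - r by ring, sub_self, zero_mul, zpow_zero]
    ring
  rw [baileyBeta_eq_sum q c (t + 2) t (S := Icc (-(M : ℤ) - 1) M)
    (Icc_subset_Icc (by omega) (by omega)), ← sub_eq_zero, ← sum_sub_distrib, ← neg_zero,
    ← hvanish, ← sum_neg_distrib]
  refine sum_congr rfl fun r _ => ?_
  have e := qFactInv_sub_one hq1 ((n : ℤ) + r + 1)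
  rw [add_sub_cancel_right] at e
  rw [e, ← thetaCoeff_mul_zpow hc0, zpow_mul, zpow_ofNat, hc, add_right_comm, zpow_add₀ hqne _ r]
  ring

lemma baileyBeta_step_twisted (t : ℤ) (n : ℕ) :
    ∑ N ∈ range (n + 1), c ^ (N ^ 2) * q ^ N * qFactInv q ((n : ℤ) - N) *
      (qPoch q (-c) N * baileyBeta q c (t + 2) t N) =
    qPoch q (-c) n * baileyBeta q c (t + 3) (t + 2) n := by
  have hc0 := ne_zero_of_sq_eq hq0 hc
  have hqne : q ≠ 0 := norm_pos_iff.mp hq0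
  have h : ∀ N ∈ range (n + 1), c ^ (N ^ 2) * q ^ N * qFactInv q ((n : ℤ) - N) *
      (qPoch q (-c) N * baileyBeta q c (t + 2) t N) =
      ∑ r ∈ Icc (-(n : ℤ) - 1) n, thetaCoeff c (t + 2) t r *
        (c ^ (N ^ 2) * q ^ N * qPoch q (-c) N * qFactInv q ((n : ℤ) - N) *
          (qFactInv q ((N : ℤ) - r) * qFactInv q ((N : ℤ) + r + 1))) := by
    intro N hN
    rw [baileyBeta_eq_sum_relative hq0 hq1 hc t (Nat.lt_succ_iff.mp (mem_range.mp hN)),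
      mul_sum, mul_sum]
    exact sum_congr rfl fun r _ => by ring
  rw [sum_congr rfl h, sum_comm, baileyBeta_eq_sum q c _ _ (S := Icc (-(n : ℤ) - 1) n)
    (Icc_subset_Icc (by omega) (by omega)), mul_sum, ← sub_eq_zero, ← sum_sub_distrib]
  refine Eq.trans (sum_congr rfl fun r _ => ?_) (sum_Icc_eq_zero_of_antisymm n (f := fun r =>
    qPoch q (-c) n * thetaCoeff c (t + 3) (t + 2) r *
      (qFactInv q ((n : ℤ) - r) * qFactInv q ((n : ℤ) + r + 1)) *
      ((c * q ^ n * (1 + c * q ^ r + (c * q ^ r) ^ 2) - c * q ^ r) / (1 + c * q ^ r)))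
    fun r => ?_)
  · have e := qFactInv_sub_one hq1 ((n : ℤ) + r + 1)
    rw [add_sub_cancel_right] at e
    have h0 := one_add_mul_zpow_ne_zero hq0 hq1 hc r
    rw [← mul_sum, baileyKernel_twisted hq0 hq1 hc, e, ← thetaCoeff_mul_zpow hc0,
      show t + 3 = t + 2 + 1 by ring, ← thetaCoeff_mul_zpow_sq hc0, zpow_mul c 2, zpow_ofNat, hc,
      zpow_add₀ hqne, zpow_add₀ hqne, zpow_one, zpow_natCast, qPoch_succ]
    generalize q ^ r = x at h0 ⊢
    generalize q ^ n = y
    rw [mul_comm c x] at h0 ⊢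
    field_simp
    rw [← hc]
    ring
  · have h0 := one_add_mul_zpow_ne_zero hq0 hq1 hc r
    have hu : c ^ ((t + 3 - (t + 2)) * (2 * r + 1)) = c * q ^ r := by
      rw [← hc, ← zpow_ofNat, ← zpow_mul, ← zpow_one_add₀ hc0]
      congr 1
      ring
    have hu' : c * q ^ (-1 - r) = (c * q ^ r)⁻¹ := by
      rw [← hc, ← zpow_ofNat, ← zpow_mul, ← zpow_mul, ← zpow_one_add₀ hc0, ← zpow_one_add₀ hc0,
        ← zpow_neg]
      congr 1
      ring
    have hune : c * q ^ r ≠ 0 := mul_ne_zero hc0 (zpow_ne_zero r hqne)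
    rw [thetaCoeff_reflect hc0, show (n : ℤ) - (-1 - r) = n + r + 1 by ring,
      show (n : ℤ) + (-1 - r) + 1 = n - r by ring, hu, hu']
    generalize c * q ^ r = u at *
    have h1 : 1 + u⁻¹ ≠ 0 := by
      rw [show 1 + u⁻¹ = (1 + u) / u by field_simp; ring]
      exact div_ne_zero h0 hune
    have h2 : (c * q ^ n * (1 + u⁻¹ + u⁻¹ ^ 2) - u⁻¹) / (1 + u⁻¹) =
        (c * q ^ n * (1 + u + u ^ 2) - u) / (1 + u) / u := by
      rw [div_div, div_eq_div_iff h1 (mul_ne_zero h0 hune)]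
      field_simp
      ring
    rw [h2]
    field_simp

end BaileySteps

open Filter Topology

lemma summable_norm_mul_pow {q : ℂ} (hq1 : ‖q‖ < 1) (x : ℂ) :
    Summable fun j : ℕ => ‖-(x * q ^ j)‖ := by
  simpa using (summable_geometric_of_lt_one (norm_nonneg q) hq1).mul_left ‖x‖

lemma tendsto_qPoch {q : ℂ} (hq1 : ‖q‖ < 1) (x : ℂ) :
    Tendsto (qPoch q x) atTop (𝓝 (qPochInf q x)) := by
  have h := multipliable_one_add_of_summable (summable_norm_mul_pow hq1 x)
  simp only [← sub_eq_add_neg] at h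
  exact h.tendsto_prod_tprod_nat

lemma qPochInf_self_ne_zero {q : ℂ} (hq1 : ‖q‖ < 1) : qPochInf q q ≠ 0 := by
  have h := tprod_one_add_ne_zero_of_summable (f := fun j : ℕ => -(q * q ^ j)) (fun j => by
    rw [← sub_eq_add_neg, ← pow_succ']
    exact one_sub_pow_succ_ne_zero hq1 j) (summable_norm_mul_pow hq1 q)
  simpa only [qPochInf, ← sub_eq_add_neg] using h

lemma exists_norm_le_of_tendsto {u : ℕ → ℂ} {x : ℂ} (h : Tendsto u atTop (𝓝 x)) :
    ∃ C, 0 ≤ C ∧ ∀ n, ‖u n‖ ≤ C := by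
  obtain ⟨C, hC⟩ := (Metric.isBounded_range_of_tendsto u h).exists_norm_le
  exact ⟨C, (norm_nonneg _).trans (hC (u 0) ⟨0, rfl⟩), fun n => hC (u n) ⟨n, rfl⟩⟩

lemma tendsto_inv_qPoch_self {q : ℂ} (hq1 : ‖q‖ < 1) :
    Tendsto (fun n => (qPoch q q n)⁻¹) atTop (𝓝 (qPochInf q q)⁻¹) :=
  (tendsto_qPoch hq1 q).inv₀ (qPochInf_self_ne_zero hq1)

lemma tendsto_qFactInv {q : ℂ} (hq1 : ‖q‖ < 1) (z : ℤ) :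
    Tendsto (fun n : ℕ => qFactInv q ((n : ℤ) + z)) atTop (𝓝 (qPochInf q q)⁻¹) := by
  have h : Tendsto (fun n : ℕ => ((n : ℤ) + z).toNat) atTop atTop :=
    tendsto_atTop.mpr fun b => by
      filter_upwards [eventually_ge_atTop (b + z.natAbs)] with n hn
      omega
  refine ((tendsto_inv_qPoch_self hq1).comp h).congr' ?_
  filter_upwards [eventually_ge_atTop z.natAbs] with n hn
  exact (if_neg (by omega)).symm

lemma exists_norm_qFactInv_le {q : ℂ} (hq1 : ‖q‖ < 1) :
    ∃ E, 0 ≤ E ∧ ∀ z, ‖qFactInv q z‖ ≤ E := by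
  obtain ⟨E, hE0, hE⟩ := exists_norm_le_of_tendsto (tendsto_inv_qPoch_self hq1)
  refine ⟨E, hE0, fun z => ?_⟩
  rw [qFactInv]
  split_ifs
  · simpa using hE0
  · exact hE _

lemma summable_prod_apply {g : ℕ → ℝ} (hg0 : ∀ n, 0 ≤ g n) (hg : Summable g) (j : ℕ) :
    Summable fun N : Fin j → ℕ => ∏ l, g (N l) := by
  induction j with
  | zero => exact Summable.of_finite
  | succ j ih =>
    rw [← (Fin.consEquiv fun _ => ℕ).summable_iff]
    refine (hg.mul_of_nonneg ih hg0 fun N => prod_nonneg fun l _ => hg0 _).congr fun N => ?_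
    simp [Fin.consEquiv, Fin.prod_univ_succ]

lemma norm_thetaCoeff_le {c : ℂ} (hc0 : c ≠ 0) (hc1 : ‖c‖ < 1) {s t : ℤ} (ht0 : 0 ≤ t)
    (ht : t < s) (r : ℤ) : ‖thetaCoeff c s t r‖ ≤ ‖c‖ ^ r.natAbs := by
  rw [thetaCoeff, norm_mul, norm_zpow, norm_neg, norm_one, one_zpow, one_mul, norm_zpow,
    ← zpow_natCast]
  refine zpow_le_zpow_right_of_le_one₀ (norm_pos_iff.mpr hc0) hc1.le ?_
  rw [Int.natCast_natAbs, ← sq_abs]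
  have h1 : |r| ≤ |r| ^ 2 := by
    rw [sq]
    rcases eq_or_lt_of_le (abs_nonneg r) with h | h
    · simp [← h]
    · nlinarith
  have h2 : t * -|r| ≤ t * r := mul_le_mul_of_nonneg_left (neg_abs_le r) ht0
  nlinarith [abs_nonneg r, sq_nonneg |r|]

lemma summable_norm_pow_natAbs {c : ℂ} (hc1 : ‖c‖ < 1) :
    Summable fun r : ℤ => ‖c‖ ^ r.natAbs := by
  have h := summable_geometric_of_lt_one (norm_nonneg c) hc1
  exact Summable.of_nat_of_neg (by simpa using h) (by simpa using h)

lemma tendsto_baileyBeta {q c : ℂ} (hq1 : ‖q‖ < 1) (hc0 : c ≠ 0) (hc1 : ‖c‖ < 1) {s t : ℤ}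
    (ht0 : 0 ≤ t) (ht : t < s) :
    Tendsto (baileyBeta q c s t) atTop
      (𝓝 (∑' r, thetaCoeff c s t r * ((qPochInf q q)⁻¹ * (qPochInf q q)⁻¹))) := by
  obtain ⟨E, hE0, hE⟩ := exists_norm_qFactInv_le hq1
  have hβ : baileyBeta q c s t = fun n : ℕ => ∑' r, thetaCoeff c s t r *
      (qFactInv q ((n : ℤ) - r) * qFactInv q ((n : ℤ) + r)) := by
    ext n
    rw [baileyBeta, tsum_eq_sum fun r hr => baileyBeta_summand_eq_zero q c s t n hr]
  rw [hβ]
  refine tendsto_tsum_of_dominated_convergence (bound := fun r => ‖c‖ ^ r.natAbs * (E * E))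
    ((summable_norm_pow_natAbs hc1).mul_right _) (fun r => ?_) (.of_forall fun n r => ?_)
  · exact ((tendsto_qFactInv hq1 (-r)).mul (tendsto_qFactInv hq1 r)).const_mul _
  · rw [norm_mul, norm_mul]
    exact mul_le_mul (norm_thetaCoeff_le hc0 hc1 ht0 ht r)
      (mul_le_mul (hE _) (hE _) (norm_nonneg _) hE0) (by positivity) (by positivity)

lemma thetaTerm_eq_add {k a : ℕ} {c : ℂ} (hc0 : c ≠ 0) (r : ℕ) :
    thetaTerm k a c (r + 1) = thetaCoeff c ((k : ℤ) + 1) ((k - a + 1 : ℕ) : ℤ) ((r : ℤ) + 1) +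
      thetaCoeff c ((k : ℤ) + 1) ((k - a + 1 : ℕ) : ℤ) (-((r : ℤ) + 1)) := by
  have h1 : ((-1 : ℂ)) ^ ((r : ℤ) + 1) = (-1) ^ (r + 1) := by
    rw [← zpow_natCast, Nat.cast_succ]
  have h2 : ((-1 : ℂ)) ^ (-((r : ℤ) + 1)) = (-1) ^ (r + 1) := by
    rw [zpow_neg, ← inv_zpow, inv_neg_one, h1]
  rw [thetaTerm, thetaCoeff, thetaCoeff, h1, h2, mul_add, mul_assoc, mul_assoc,
    ← zpow_natCast c, ← zpow_natCast c, ← zpow_add₀ hc0, ← zpow_add₀ hc0]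
  congr 3

lemma thetaTerm_summable_and_tsum {k a : ℕ} {c : ℂ} (hc0 : c ≠ 0) (hc1 : ‖c‖ < 1)
    (ha : 1 ≤ a) (hak : a < k) :
    Summable (fun r : ℕ => thetaTerm k a c (r + 1)) ∧
    ∑' r, thetaCoeff c ((k : ℤ) + 1) ((k - a + 1 : ℕ) : ℤ) r =
      1 + ∑' r : ℕ, thetaTerm k a c (r + 1) := by
  set f := thetaCoeff c ((k : ℤ) + 1) ((k - a + 1 : ℕ) : ℤ) with hf
  have hs : Summable f := (summable_norm_pow_natAbs hc1).of_norm_bounded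
    (norm_thetaCoeff_le hc0 hc1 (by omega) (by omega))
  have h1 : Summable fun r : ℕ => f ((r : ℤ) + 1) :=
    hs.comp_injective (i := fun r : ℕ => (r : ℤ) + 1) fun x y h => by simpa using h
  have h2 : Summable fun r : ℕ => f (-((r : ℤ) + 1)) :=
    hs.comp_injective (i := fun r : ℕ => -((r : ℤ) + 1)) fun x y h => by simpa using h
  have h0 : f 0 = 1 := by simp [hf, thetaCoeff]
  simp only [thetaTerm_eq_add hc0, ← hf]
  refine ⟨h1.add h2, ?_⟩
  rw [tsum_of_add_one_of_neg_add_one h1 h2, h1.tsum_add h2, h0]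
  ring

/-- The factor `c^(N²)`, or `c^(N²) q^N` at the positions `i = a, a + 2, …`. -/
noncomputable def stepWeight (a : ℕ) (q c : ℂ) (i N : ℕ) : ℂ :=
  c ^ (N ^ 2) * if a ≤ i ∧ i % 2 = a % 2 then q ^ N else 1

/-- The summand of the iterated Bailey sum over `N_i, …, N_{i+j-1}`, bounded above by `n`. -/
noncomputable def chainTerm (a : ℕ) (q c : ℂ) : (j i n : ℕ) → (Fin j → ℕ) → ℂ
  | 0, _, n, _ => qPoch q (-c) n * (qPoch (q ^ 2) (q ^ 2) n)⁻¹
  | j + 1, i, n, N => qFactInv q ((n : ℤ) - N 0) * stepWeight a q c i (N 0) *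
      chainTerm a q c j (i + 1) (N 0) (Fin.tail N)

/-- The linear coefficient of the theta exponent reached at position `i`. -/
def linearExp (k a i : ℕ) : ℕ := if i ≤ a then k - a + 1 else 2 * ((k - i + 1) / 2)

section Chain

variable {q c : ℂ} (hq0 : 0 < ‖q‖) (hq1 : ‖q‖ < 1) (hc : c ^ 2 = q)

include hq1 hc in
lemma norm_stepWeight_le (a i N : ℕ) : ‖stepWeight a q c i N‖ ≤ ‖c‖ ^ N := by
  have hc1 := (norm_lt_one_of_sq_eq hq1 hc).le
  have h1 : ‖c ^ (N ^ 2)‖ ≤ ‖c‖ ^ N := by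
    rw [norm_pow]
    exact pow_le_pow_of_le_one (norm_nonneg c) hc1 (Nat.le_self_pow two_ne_zero N)
  have h2 : ‖if a ≤ i ∧ i % 2 = a % 2 then q ^ N else 1‖ ≤ 1 := by
    split_ifs
    · rw [norm_pow]
      exact pow_le_one₀ (norm_nonneg q) hq1.le
    · simp
  rw [stepWeight, norm_mul]
  exact (mul_le_mul h1 h2 (norm_nonneg _) (by positivity)).trans_eq (mul_one _)

include hq1 hc in
lemma exists_norm_chainTerm_le (a : ℕ) : ∃ B E : ℝ, 0 ≤ B ∧ 0 ≤ E ∧ ∀ j i n (N : Fin j → ℕ),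
    ‖chainTerm a q c j i n N‖ ≤ B * ∏ l, E * ‖c‖ ^ N l := by
  have hq2 : ‖q ^ 2‖ < 1 := by
    rw [norm_pow]
    exact pow_lt_one₀ (norm_nonneg q) hq1 two_ne_zero
  obtain ⟨B, hB0, hB⟩ := exists_norm_le_of_tendsto
    ((tendsto_qPoch hq1 (-c)).mul (tendsto_inv_qPoch_self hq2))
  obtain ⟨E, hE0, hE⟩ := exists_norm_qFactInv_le hq1
  refine ⟨B, E, hB0, hE0, fun j => ?_⟩
  induction j with
  | zero => exact fun i n N => by simpa [chainTerm] using hB n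
  | succ j ih =>
    intro i n N
    rw [chainTerm, norm_mul, norm_mul, Fin.prod_univ_succ, mul_left_comm]
    exact mul_le_mul (mul_le_mul (hE _) (norm_stepWeight_le hq1 hc _ _ _) (norm_nonneg _) hE0)
      (ih _ _ _) (norm_nonneg _) (by positivity)

include hq1 hc in
lemma summable_chainTerm (a j i n : ℕ) : Summable (chainTerm a q c j i n) := by
  obtain ⟨B, E, hB, hE, h⟩ := exists_norm_chainTerm_le hq1 hc a
  have hc1 := norm_lt_one_of_sq_eq hq1 hc
  exact ((summable_prod_apply (fun n => by positivity)
    ((summable_geometric_of_lt_one (norm_nonneg c) hc1).mul_left E) j).mul_left B).of_norm_bounded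
    (h j i n)

include hq1 hc in
lemma summable_stepWeight_mul_chainTerm (a j i : ℕ) :
    Summable fun N : Fin (j + 1) → ℕ =>
      stepWeight a q c i (N 0) * chainTerm a q c j (i + 1) (N 0) (Fin.tail N) := by
  obtain ⟨B, E, hB, hE, h⟩ := exists_norm_chainTerm_le hq1 hc a
  have hc1 := norm_lt_one_of_sq_eq hq1 hc
  have hE1 : ∀ n, 0 ≤ (E + 1) * ‖c‖ ^ n := fun n => by positivity
  refine ((summable_prod_apply hE1 ((summable_geometric_of_lt_one (norm_nonneg c) hc1).mul_left
    (E + 1)) (j + 1)).mul_left B).of_norm_bounded fun N => ?_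
  rw [norm_mul, Fin.prod_univ_succ, mul_left_comm]
  refine mul_le_mul ((norm_stepWeight_le hq1 hc _ _ _).trans ?_) ((h _ _ _ _).trans ?_)
    (norm_nonneg _) (hE1 _)
  · exact le_mul_of_one_le_left (by positivity) (by linarith)
  · refine mul_le_mul_of_nonneg_left (prod_le_prod (fun _ _ => by positivity) fun l _ => ?_) hB
    exact mul_le_mul_of_nonneg_right (by linarith) (by positivity)

include hq0 hq1 hc in
lemma sum_stepWeight_baileyBeta {k a i : ℕ} (hak : a < k) (hodd : Odd (k - a)) (hi : i < k)
    (n : ℕ) :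
    ∑ N ∈ range (n + 1), qFactInv q ((n : ℤ) - N) * (stepWeight a q c i N *
      (qPoch q (-c) N * baileyBeta q c (((k - (i + 1) + 2 : ℕ) : ℤ)) (linearExp k a (i + 1)) N)) =
    qPoch q (-c) n * baileyBeta q c ((k - i + 2 : ℕ) : ℤ) (linearExp k a i) n := by
  obtain ⟨m, hm⟩ := hodd
  by_cases h : a ≤ i ∧ i % 2 = a % 2
  · have h1 : ((k - (i + 1) + 2 : ℕ) : ℤ) = (linearExp k a (i + 1) : ℤ) + 2 := by
      rw [linearExp, if_neg (by omega)]
      omega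
    have h2 : ((k - i + 2 : ℕ) : ℤ) = (linearExp k a (i + 1) : ℤ) + 3 := by omega
    have h3 : (linearExp k a i : ℤ) = (linearExp k a (i + 1) : ℤ) + 2 := by
      rw [linearExp, linearExp, if_neg (show ¬ i + 1 ≤ a by omega)]
      split_ifs <;> omega
    rw [h1, h2, h3, ← baileyBeta_step_twisted hq0 hq1 hc]
    refine sum_congr rfl fun N _ => ?_
    rw [stepWeight, if_pos h]
    ring
  · have h2 : ((k - i + 2 : ℕ) : ℤ) = ((k - (i + 1) + 2 : ℕ) : ℤ) + 1 := by omega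
    have h3 : linearExp k a i = linearExp k a (i + 1) := by
      rw [linearExp, linearExp]
      split_ifs <;> omega
    rw [h2, h3, ← baileyBeta_step hq0 hq1 hc]
    refine sum_congr rfl fun N _ => ?_
    rw [stepWeight, if_neg h]
    ring

include hq0 hq1 hc in
lemma hasSum_chainTerm {k a : ℕ} (hak : a < k) (hodd : Odd (k - a)) (j : ℕ) :
    ∀ i n, i + j = k → HasSum (chainTerm a q c j i n)
      (qPoch q (-c) n * baileyBeta q c ((k - i + 2 : ℕ) : ℤ) (linearExp k a i) n) := by
  induction j with
  | zero =>
    rintro i n rfl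
    have h : linearExp (i + 0) a i = 0 := by simp [linearExp]; omega
    rw [h, show ((i + 0 - i + 2 : ℕ) : ℤ) = 2 by simp, Nat.cast_zero,
      baileyBeta_two_zero hq0 hq1 hc]
    exact hasSum_unique _
  | succ j ih =>
    intro i n hk
    have hs := ((Fin.consEquiv fun _ => ℕ).summable_iff.mpr
      (summable_chainTerm hq1 hc a (j + 1) i n)).hasSum
    have hfib := hs.prod_fiberwise fun N₀ => by
      simpa [Fin.consEquiv, chainTerm] using (ih (i + 1) N₀ (by omega)).mul_left
        (qFactInv q ((n : ℤ) - N₀) * stepWeight a q c i N₀)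
    rw [← (Fin.consEquiv fun _ => ℕ).hasSum_iff]
    convert hs using 1
    refine HasSum.unique ?_ hfib
    rw [← sum_stepWeight_baileyBeta hq0 hq1 hc hak hodd (by omega)]
    simp only [← mul_assoc]
    refine hasSum_sum_of_ne_finset_zero fun N hN => ?_
    rw [qFactInv_of_neg q (show (n : ℤ) - N < 0 by simp at hN; omega)]
    ring

include hq0 hq1 hc in
lemma tsum_stepWeight_mul_chainTerm {k a j : ℕ} (ha : 1 ≤ a) (hak : a < k) (hodd : Odd (k - a))
    (hj : j + 2 = k) :
    ∑' N : Fin (j + 1) → ℕ, stepWeight a q c 1 (N 0) * chainTerm a q c j 2 (N 0) (Fin.tail N) =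
      qPochInf q (-c) / qPochInf q q *
        ∑' r, thetaCoeff c ((k : ℤ) + 1) ((k - a + 1 : ℕ) : ℤ) r := by
  have hc0 := ne_zero_of_sq_eq hq0 hc
  have hc1 := norm_lt_one_of_sq_eq hq1 hc
  have hinf := qPochInf_self_ne_zero hq1
  obtain ⟨E, hE0, hE⟩ := exists_norm_qFactInv_le hq1
  set g : ℕ → ℂ := fun N => stepWeight a q c 1 N * (qPoch q (-c) N *
    baileyBeta q c ((k - (1 + 1) + 2 : ℕ) : ℤ) (linearExp k a (1 + 1)) N) with hg
  have hsum := summable_stepWeight_mul_chainTerm hq1 hc a j 1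
  have hs := (Fin.consEquiv fun _ => ℕ).hasSum_iff.mpr hsum.hasSum
  have hfib : HasSum g _ := hs.prod_fiberwise fun N₀ => by
    simpa [Fin.consEquiv, hg] using (hasSum_chainTerm hq0 hq1 hc hak hodd j 2 N₀ (by omega)).mul_left
      (stepWeight a q c 1 N₀)
  rw [← hfib.tsum_eq]
  have hlim : Tendsto (fun n : ℕ => ∑' N : ℕ, qFactInv q ((n : ℤ) - N) * g N) atTop
      (𝓝 (∑' N, (qPochInf q q)⁻¹ * g N)) := by
    refine tendsto_tsum_of_dominated_convergence (bound := fun N => E * ‖g N‖)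
      (hfib.summable.norm.mul_left E) (fun N => ?_) (.of_forall fun n N => ?_)
    · exact (tendsto_qFactInv hq1 (-(N : ℤ))).mul_const _
    · rw [norm_mul]
      exact mul_le_mul_of_nonneg_right (hE _) (norm_nonneg _)
  have hlim' := (tendsto_qPoch hq1 (-c)).mul (tendsto_baileyBeta hq1 hc0 hc1
    (s := (k : ℤ) + 1) (t := ((k - a + 1 : ℕ) : ℤ)) (by omega) (by omega))
  have heq : ∀ n : ℕ, ∑' N : ℕ, qFactInv q ((n : ℤ) - N) * g N =
      qPoch q (-c) n * baileyBeta q c ((k : ℤ) + 1) ((k - a + 1 : ℕ) : ℤ) n := by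
    intro n
    have h1 : ((k - 1 + 2 : ℕ) : ℤ) = (k : ℤ) + 1 := by omega
    have h2 : linearExp k a 1 = k - a + 1 := if_pos ha
    rw [← h1, ← h2, ← sum_stepWeight_baileyBeta hq0 hq1 hc hak hodd (by omega)]
    refine tsum_eq_sum fun N hN => ?_
    rw [qFactInv_of_neg q (show (n : ℤ) - N < 0 by simp at hN; omega), zero_mul]
  have hu := tendsto_nhds_unique (hlim.congr heq) hlim'
  rw [tsum_mul_left, tsum_mul_right] at hu
  field_simp at hu ⊢
  linear_combination hu

end Chain

lemma chainTerm_eq_prod (a : ℕ) (q c : ℂ) (x : ℕ → ℕ) (j : ℕ) : ∀ i,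
    chainTerm a q c j (i + 1) (x i) (fun l => x (i + 1 + l)) =
      (∏ l ∈ range j, qFactInv q ((x (i + l) : ℤ) - x (i + l + 1)) *
        stepWeight a q c (i + l + 1) (x (i + l + 1))) *
      (qPoch q (-c) (x (i + j)) * (qPoch (q ^ 2) (q ^ 2) (x (i + j)))⁻¹) := by
  induction j with
  | zero => exact fun i => by simp [chainTerm]
  | succ j ih =>
    intro i
    have htail : Fin.tail (fun l : Fin (j + 1) => x (i + 1 + l)) =
        fun l : Fin j => x (i + 1 + 1 + l) := by
      funext l
      simp only [Fin.tail, Fin.val_succ]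
      congr 1
      omega
    rw [chainTerm, htail]
    simp only [Fin.val_zero, Nat.add_zero]
    rw [ih, prod_range_succ']
    simp only [Nat.add_zero, show ∀ l, i + 1 + l = i + (l + 1) by intro l; omega]
    ring

lemma prod_Icc_one_eq_prod_range {M : Type*} [CommMonoid M] (f : ℕ → M) (n : ℕ) :
    ∏ i ∈ Icc 1 n, f i = ∏ l ∈ range n, f (l + 1) := by
  induction n with
  | zero => simp
  | succ n ih => rw [prod_Icc_succ_top (by omega), ih, prod_range_succ]

lemma ext_succ_val {m : ℕ} (N : Fin m → ℕ) (l : Fin m) : ext m N (l + 1) = N l := by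
  simp [_root_.ext]

lemma stepWeight_mul_chainTerm_eq (a j : ℕ) (q c : ℂ) (N : Fin (j + 1) → ℕ) :
    stepWeight a q c 1 (N 0) * chainTerm a q c j 2 (N 0) (Fin.tail N) =
      (∏ l ∈ range (j + 1), stepWeight a q c (l + 1) (ext (j + 1) N (l + 1))) *
      (∏ l ∈ range j, qFactInv q ((ext (j + 1) N (l + 1) : ℤ) - ext (j + 1) N (l + 2))) *
      (qPoch q (-c) (ext (j + 1) N (j + 1)) *
        (qPoch (q ^ 2) (q ^ 2) (ext (j + 1) N (j + 1)))⁻¹) := by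
  have h0 : N 0 = ext (j + 1) N 1 := (ext_succ_val N 0).symm
  have htail : Fin.tail N = fun l : Fin j => ext (j + 1) N (1 + 1 + l) := by
    funext l
    rw [Fin.tail, ← ext_succ_val N l.succ, Fin.val_succ]
    congr 1
    omega
  rw [htail, h0, chainTerm_eq_prod a q c (ext (j + 1) N) j 1, prod_mul_distrib,
    prod_range_succ' _ j]
  simp only [show ∀ l, 1 + l = l + 1 from fun l => Nat.add_comm 1 l]
  ring

lemma prod_stepWeight_eq {a : ℕ} (ha : 1 ≤ a) (q c : ℂ) (x : ℕ → ℕ) (m : ℕ) :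
    ∏ l ∈ range m, stepWeight a q c (l + 1) (x (l + 1)) =
      c ^ (∑ i ∈ Icc 1 m, x i ^ 2) *
        q ^ (∑ i ∈ (Icc a m).filter (fun i => i % 2 = a % 2), x i) := by
  have hfilter : (Icc a m).filter (fun i => i % 2 = a % 2) =
      (Icc 1 m).filter (fun i => a ≤ i ∧ i % 2 = a % 2) := by
    ext i
    simp only [mem_filter, mem_Icc]
    omega
  rw [← prod_Icc_one_eq_prod_range (fun i => stepWeight a q c i (x i)), hfilter,
    ← prod_pow_eq_pow_sum, ← prod_pow_eq_pow_sum, prod_filter, ← prod_mul_distrib]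
  rfl

lemma halfTerm_eq_of_antitone {a j : ℕ} (ha : 1 ≤ a) (q c : ℂ) {N : Fin (j + 1) → ℕ}
    (hN : Antitone N) :
    halfTerm (j + 2) a q c N =
      stepWeight a q c 1 (N 0) * chainTerm a q c j 2 (N 0) (Fin.tail N) := by
  have hprod : ∏ l ∈ range j, qFactInv q ((ext (j + 1) N (l + 1) : ℤ) - ext (j + 1) N (l + 2)) =
      (∏ i ∈ Icc 1 j, qPoch q q (ext (j + 1) N i - ext (j + 1) N (i + 1)))⁻¹ := by
    rw [prod_Icc_one_eq_prod_range, ← prod_inv_distrib]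
    refine prod_congr rfl fun l hl => ?_
    have hl := mem_range.mp hl
    have hle : ext (j + 1) N (l + 2) ≤ ext (j + 1) N (l + 1) := by
      have h1 := ext_succ_val N ⟨l + 1, by omega⟩
      have h2 := ext_succ_val N ⟨l, by omega⟩
      rw [h1, h2]
      exact hN (Fin.mk_le_mk.mpr (Nat.le_succ l))
    rw [← Nat.cast_sub hle, qFactInv_natCast]
  rw [stepWeight_mul_chainTerm_eq, prod_stepWeight_eq ha, hprod]
  change c ^ (∑ i ∈ Icc 1 (j + 1), ext (j + 1) N i ^ 2) *
    q ^ (∑ i ∈ (Icc a (j + 1)).filter (fun i => i % 2 = a % 2), ext (j + 1) N i) *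
    qPoch q (-c) (ext (j + 1) N (j + 1)) /
      ((∏ i ∈ Icc 1 j, qPoch q q (ext (j + 1) N i - ext (j + 1) N (i + 1))) *
        qPoch (q ^ 2) (q ^ 2) (ext (j + 1) N (j + 1))) = _
  rw [div_eq_mul_inv, mul_inv]
  ring

lemma stepWeight_mul_chainTerm_eq_zero (a : ℕ) {j : ℕ} (q c : ℂ) {N : Fin (j + 1) → ℕ}
    (hN : ¬ Antitone N) :
    stepWeight a q c 1 (N 0) * chainTerm a q c j 2 (N 0) (Fin.tail N) = 0 := by
  rw [Fin.antitone_iff_succ_le] at hN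
  push Not at hN
  obtain ⟨l, hl⟩ := hN
  have h1 := ext_succ_val N l.succ
  have h2 := ext_succ_val N l.castSucc
  rw [Fin.val_succ] at h1
  rw [Fin.val_castSucc] at h2
  rw [stepWeight_mul_chainTerm_eq, prod_eq_zero (mem_range.mpr l.isLt)]
  · ring
  · rw [h2, h1]
    exact qFactInv_of_neg q (by omega)

lemma tsum_subtype_eq_of_forall_eq_zero {α : Type*} {p : α → Prop} {f : α → ℂ}
    (h : ∀ x, ¬ p x → f x = 0) : ∑' x : {x // p x}, f x = ∑' x, f x := by
  refine tsum_subtype_eq_of_support_subset (s := {x | p x}) fun x hx => ?_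
  by_contra hp
  exact hx (h x hp)

/-- Identity (4.1), obtained by letting `n → ∞` in the Bailey pair relation; `c` is a
fixed square root of `q` (so `c^{N²} = q^{N²/2}`). -/
theorem limit_identity (k a : ℕ) (ha : 1 ≤ a) (hak : a < k) (hodd : Odd (k - a))
    (q c : ℂ) (hq0 : 0 < ‖q‖) (hq1 : ‖q‖ < 1) (hc : c ^ 2 = q) :
    Summable (fun N : {N : Fin (k - 1) → ℕ // Antitone N} => halfTerm k a q c N.1) ∧
    Summable (fun r : ℕ => thetaTerm k a c (r + 1)) ∧
    ∑' N : {N : Fin (k - 1) → ℕ // Antitone N}, halfTerm k a q c N.1 =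
      qPochInf q (-c) / qPochInf q q * (1 + ∑' r : ℕ, thetaTerm k a c (r + 1)) := by
  obtain ⟨j, rfl⟩ : ∃ j, k = j + 2 := ⟨k - 2, by omega⟩
  have hc0 := ne_zero_of_sq_eq hq0 hc
  obtain ⟨hsummable, htheta⟩ :=
    thetaTerm_summable_and_tsum hc0 (norm_lt_one_of_sq_eq hq1 hc) ha hak
  have hchain := summable_stepWeight_mul_chainTerm hq1 hc a j 1
  have hterm : ∀ N : {N : Fin (j + 1) → ℕ // Antitone N}, halfTerm (j + 2) a q c N.1 =
      stepWeight a q c 1 (N.1 0) * chainTerm a q c j 2 (N.1 0) (Fin.tail N.1) :=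
    fun N => halfTerm_eq_of_antitone ha q c N.2
  have hsubtype : ∑' N : {N : Fin (j + 1) → ℕ // Antitone N},
        stepWeight a q c 1 (N.1 0) * chainTerm a q c j 2 (N.1 0) (Fin.tail N.1) =
      ∑' N : Fin (j + 1) → ℕ,
        stepWeight a q c 1 (N 0) * chainTerm a q c j 2 (N 0) (Fin.tail N) :=
    tsum_subtype_eq_of_forall_eq_zero fun N hN => stepWeight_mul_chainTerm_eq_zero a q c hN
  have hval := tsum_stepWeight_mul_chainTerm (j := j) hq0 hq1 hc ha hak hodd rfl
  rw [htheta] at hval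
  exact ⟨(hchain.comp_injective Subtype.val_injective).congr fun N => (hterm N).symm,
    hsummable,
    (tsum_congr hterm).trans (hsubtype.trans hval)⟩
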